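/- Assume (A2). Then the inverse h^{-1} of h has the doubling property on (0,r) for every r > 0, i.e. for every r > 0 there is C ≥ 1 with h^{-1}(u) ≤ C h^{-1}(2u) whenever 0 < 2u < r. Moreover, for every r > 0 there is a constant c ≥ 1 such that c^{-1}/h^{-1}(u) ≤ ψ^{-1}(u) ≤ c/h^{-1}(u) for all 0 < u < r. -/

import Mathlib

open MeasureTheory Filter Real
open scoped RealInnerProductSpace

noncomputable section

/-- Pruitt's concentration function `K(r) = r⁻² ∫_{|z|<r} |z|² ν(|z|) dz`. -/
def K (d : ℕ) (ν : ℝ → ℝ) (r : ℝ) : ℝ :=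
  (∫ z in Metric.ball (0 : EuclideanSpace ℝ (Fin d)) r, ‖z‖ ^ 2 * ν ‖z‖) / r ^ 2

/-- Pruitt's concentration function `h(r) = ∫ (|z|²/r² ∧ 1) ν(|z|) dz`. -/
def hfun (d : ℕ) (ν : ℝ → ℝ) (r : ℝ) : ℝ :=
  ∫ z : EuclideanSpace ℝ (Fin d), min (‖z‖ ^ 2 / r ^ 2) 1 * ν ‖z‖

/-- The characteristic (Lévy–Khintchine) exponent `ψ(ξ) = ∫ (1 - cos⟪ξ,z⟫) ν(|z|) dz`. -/
def ψ (d : ℕ) (ν : ℝ → ℝ) (ξ : EuclideanSpace ℝ (Fin d)) : ℝ :=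
  ∫ z : EuclideanSpace ℝ (Fin d), (1 - Real.cos ⟪ξ, z⟫) * ν ‖z‖

/-- The radial nondecreasing majorant `ψ*(r) = sup_{|z| ≤ r} ψ(z)`. -/
def ψstar (d : ℕ) (ν : ℝ → ℝ) (r : ℝ) : ℝ :=
  sSup {y : ℝ | ∃ z : EuclideanSpace ℝ (Fin d), ‖z‖ ≤ r ∧ ψ d ν z = y}

/-- The generalized inverse `ψ⁻¹(u) = sup {r ≥ 0 : ψ*(r) = u}`. -/
def ψinv (d : ℕ) (ν : ℝ → ℝ) (u : ℝ) : ℝ :=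
  sSup {r : ℝ | 0 ≤ r ∧ ψstar d ν r = u}

/-- Characteristic exponent `ψˢ(ξ) = s·ψ(ψ⁻¹(1/s)ξ)` of the rescaled process. -/
def ψs (d : ℕ) (ν : ℝ → ℝ) (s : ℝ) (ξ : EuclideanSpace ℝ (Fin d)) : ℝ :=
  s * ψ d ν (ψinv d ν (1 / s) • ξ)

/-- Lévy density `νˢ(x) = s·ψ⁻¹(1/s)^{-d}·ν(x/ψ⁻¹(1/s))` of the rescaled process. -/
def νs (d : ℕ) (ν : ℝ → ℝ) (s : ℝ) (x : EuclideanSpace ℝ (Fin d)) : ℝ :=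
  s / ψinv d ν (1 / s) ^ d * ν (‖x‖ / ψinv d ν (1 / s))

/-- `ψ^{-1,s}(u) = ψ⁻¹(u/s)/ψ⁻¹(1/s)`. -/
def ψinvs (d : ℕ) (ν : ℝ → ℝ) (s u : ℝ) : ℝ :=
  ψinv d ν (u / s) / ψinv d ν (1 / s)

/-- The stable constant `𝒜(d,α)`. -/
def Aconst (d : ℕ) (α : ℝ) : ℝ :=
  α * (2 : ℝ) ^ (α - 1) * Real.Gamma (((d : ℝ) + α) / 2) /
    (Real.Gamma (1 - α / 2) * Real.pi ^ ((d : ℝ) / 2))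

/-- Heat kernel of the rescaled process, via Fourier inversion. -/
def pts (d : ℕ) (ν : ℝ → ℝ) (s t : ℝ) (x : EuclideanSpace ℝ (Fin d)) : ℝ :=
  ((2 * Real.pi) ^ d)⁻¹ *
    ∫ ξ : EuclideanSpace ℝ (Fin d), Real.cos ⟪ξ, x⟫ * Real.exp (-(t * ψs d ν s ξ))

/-- Heat kernel of the isotropic α-stable process. -/
def ptα (d : ℕ) (α t : ℝ) (x : EuclideanSpace ℝ (Fin d)) : ℝ :=
  ((2 * Real.pi) ^ d)⁻¹ *
    ∫ ξ : EuclideanSpace ℝ (Fin d), Real.cos ⟪ξ, x⟫ * Real.exp (-(t * ‖ξ‖ ^ α))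

/-- Heat kernel of the original process, via Fourier inversion. -/
def pt (d : ℕ) (ν : ℝ → ℝ) (t : ℝ) (x : EuclideanSpace ℝ (Fin d)) : ℝ :=
  ((2 * Real.pi) ^ d)⁻¹ *
    ∫ ξ : EuclideanSpace ℝ (Fin d), Real.cos ⟪ξ, x⟫ * Real.exp (-(t * ψ d ν ξ))

section Trigonometric

lemma one_sub_cos_le_two_mul_min (x : ℝ) : 1 - Real.cos x ≤ 2 * min (x ^ 2) 1 := by
  rcases le_total (x ^ 2) 1 with h | h
  · rw [min_eq_left h]; nlinarith [Real.one_sub_sq_div_two_le_cos (x := x), sq_nonneg x]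
  · rw [min_eq_right h]; nlinarith [Real.neg_one_le_cos x]

lemma mul_min_le_sub_sin {y : ℝ} (hy : 0 < y) : 1 / 20 * min (y ^ 2) 1 * y ≤ y - Real.sin y := by
  rcases le_total y 1 with h | h
  · have h1 := (abs_le.1 (Real.sin_bound (x := y) (by rwa [abs_of_pos hy]))).2
    rw [abs_of_pos hy] at h1
    have h2 : y ^ 4 ≤ y ^ 3 := pow_le_pow_of_le_one hy.le h (by norm_num)
    have h3 : min (y ^ 2) 1 * y ≤ y ^ 2 * y := by gcongr; exact min_le_left _ _
    have h4 : 0 < y ^ 3 := by positivity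
    nlinarith
  · have h0 := (abs_le.1 (Real.sin_bound (x := 1) (by norm_num))).2
    norm_num at h0
    have h3 : min (y ^ 2) 1 * y ≤ 1 * y := by gcongr; exact min_le_right _ _
    rcases le_total y 2 with h2 | h2
    · have e : Real.sin y = Real.sin 1 * Real.cos (y - 1) + Real.cos 1 * Real.sin (y - 1) := by
        rw [← Real.sin_add]; ring_nf
      have a1 : Real.sin 1 * Real.cos (y - 1) ≤ Real.sin 1 * 1 :=
        mul_le_mul_of_nonneg_left (Real.cos_le_one _)
          (Real.sin_nonneg_of_nonneg_of_le_pi (by norm_num) (by linarith [Real.pi_gt_three]))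
      have a2 : Real.cos 1 * Real.sin (y - 1) ≤ 1 * (y - 1) :=
        mul_le_mul (Real.cos_le_one _) (Real.sin_le (by linarith))
          (Real.sin_nonneg_of_nonneg_of_le_pi (by linarith) (by linarith [Real.pi_gt_three]))
          (by norm_num)
      linarith
    · linarith [Real.sin_le_one y]

lemma mul_min_le_integral_one_sub_cos (y : ℝ) :
    1 / 20 * min (y ^ 2) 1 ≤ ∫ s in (0:ℝ)..1, (1 - Real.cos (s * y)) := by
  wlog hy : 0 ≤ y generalizing y
  · have := this (-y) (by linarith)
    simpa using this
  rcases hy.eq_or_lt with rfl | hy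
  · simp
  rw [intervalIntegral.integral_sub (by simp) (by
    apply Continuous.intervalIntegrable; fun_prop)]
  rw [intervalIntegral.integral_comp_mul_right _ hy.ne']
  simp only [intervalIntegral.integral_const, integral_cos, smul_eq_mul, zero_mul, one_mul,
    Real.sin_zero, sub_zero, mul_one]
  have := mul_min_le_sub_sin hy
  rw [← mul_le_mul_iff_left₀ hy, sub_mul, inv_mul_eq_div, div_mul_cancel₀ _ hy.ne', one_mul]
  exact this

end Trigonometric

lemma min_mul_le_max_mul_min {a b : ℝ} (hb : 0 ≤ b) : min (a * b) 1 ≤ max a 1 * min b 1 := by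
  rcases le_total b 1 with h | h
  · rw [min_eq_left h]
    exact (min_le_left _ _).trans (by gcongr; exact le_max_left _ _)
  · rw [min_eq_right h, mul_one]
    exact (min_le_right _ _).trans (le_max_right _ _)

section Levy

variable {d : ℕ} {ν : ℝ → ℝ}

lemma aestronglyMeasurable_levy (hd : 1 ≤ d)
    (hint : Integrable (fun z : EuclideanSpace ℝ (Fin d) => min (‖z‖ ^ 2) 1 * ν ‖z‖)) :
    AEStronglyMeasurable (fun z : EuclideanSpace ℝ (Fin d) => ν ‖z‖) := by
  have : Nonempty (Fin d) := ⟨⟨0, hd⟩⟩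
  have h1 : AEStronglyMeasurable
      (fun z : EuclideanSpace ℝ (Fin d) => (min (‖z‖ ^ 2) 1)⁻¹ * (min (‖z‖ ^ 2) 1 * ν ‖z‖)) := by
    refine AEStronglyMeasurable.mul ?_ hint.1
    exact Measurable.aestronglyMeasurable (by fun_prop)
  refine h1.congr ?_
  filter_upwards [Measure.ae_ne volume (0 : EuclideanSpace ℝ (Fin d))] with z hz
  have : 0 < min (‖z‖ ^ 2) 1 := lt_min (by positivity) one_pos
  field_simp

lemma ae_levy_pos (hd : 1 ≤ d) (hν_pos : ∀ r : ℝ, 0 < r → 0 < ν r) :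
    ∀ᵐ z : EuclideanSpace ℝ (Fin d), 0 < ‖z‖ ∧ 0 < ν ‖z‖ := by
  have : Nonempty (Fin d) := ⟨⟨0, hd⟩⟩
  filter_upwards [Measure.ae_ne volume (0 : EuclideanSpace ℝ (Fin d))] with z hz
  exact ⟨norm_pos_iff.2 hz, hν_pos _ (norm_pos_iff.2 hz)⟩

/-- A measurable multiplier dominated by `|z|² ∧ 1` is integrable against a Lévy density. -/
lemma integrable_mul_levy (hd : 1 ≤ d) (hν_pos : ∀ r : ℝ, 0 < r → 0 < ν r)
    (hint : Integrable (fun z : EuclideanSpace ℝ (Fin d) => min (‖z‖ ^ 2) 1 * ν ‖z‖))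
    {f : EuclideanSpace ℝ (Fin d) → ℝ} (hf : AEStronglyMeasurable f) (c : ℝ)
    (hfc : ∀ z, |f z| ≤ c * min (‖z‖ ^ 2) 1) :
    Integrable (fun z => f z * ν ‖z‖) := by
  refine (hint.const_mul c).mono' (hf.mul (aestronglyMeasurable_levy hd hint)) ?_
  filter_upwards [ae_levy_pos hd hν_pos] with z hz
  rw [Real.norm_eq_abs, abs_mul, abs_of_pos hz.2, ← mul_assoc]
  exact mul_le_mul_of_nonneg_right (hfc z) hz.2.le

lemma integrable_min_mul_levy (hd : 1 ≤ d) (hν_pos : ∀ r : ℝ, 0 < r → 0 < ν r)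
    (hint : Integrable (fun z : EuclideanSpace ℝ (Fin d) => min (‖z‖ ^ 2) 1 * ν ‖z‖)) (r : ℝ) :
    Integrable (fun z : EuclideanSpace ℝ (Fin d) => min (‖z‖ ^ 2 / r ^ 2) 1 * ν ‖z‖) := by
  refine integrable_mul_levy hd hν_pos hint (Measurable.aestronglyMeasurable (by fun_prop))
    (max (r ^ 2)⁻¹ 1) fun z => ?_
  rw [abs_of_nonneg (by positivity), div_eq_inv_mul]
  exact min_mul_le_max_mul_min (by positivity)

lemma one_sub_cos_inner_le (ξ z : EuclideanSpace ℝ (Fin d)) {r : ℝ} (hξ : ‖ξ‖ ≤ r) :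
    1 - Real.cos ⟪ξ, z⟫ ≤ 2 * min (r ^ 2 * ‖z‖ ^ 2) 1 := by
  refine (one_sub_cos_le_two_mul_min _).trans ?_
  gcongr
  rw [← mul_pow, ← sq_abs]
  gcongr
  exact (abs_real_inner_le_norm ξ z).trans (by gcongr)

lemma abs_one_sub_cos_inner_le (ξ z : EuclideanSpace ℝ (Fin d)) {r : ℝ} (hξ : ‖ξ‖ ≤ r) :
    |1 - Real.cos ⟪ξ, z⟫| ≤ 2 * max (r ^ 2) 1 * min (‖z‖ ^ 2) 1 := by
  rw [abs_of_nonneg (by linarith [Real.cos_le_one ⟪ξ, z⟫]), mul_assoc]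
  exact (one_sub_cos_inner_le ξ z hξ).trans
    (by gcongr; exact min_mul_le_max_mul_min (by positivity))

lemma integrable_one_sub_cos_mul_levy (hd : 1 ≤ d) (hν_pos : ∀ r : ℝ, 0 < r → 0 < ν r)
    (hint : Integrable (fun z : EuclideanSpace ℝ (Fin d) => min (‖z‖ ^ 2) 1 * ν ‖z‖))
    (ξ : EuclideanSpace ℝ (Fin d)) :
    Integrable (fun z : EuclideanSpace ℝ (Fin d) => (1 - Real.cos ⟪ξ, z⟫) * ν ‖z‖) :=
  integrable_mul_levy hd hν_pos hint (Continuous.aestronglyMeasurable (by fun_prop)) _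
    fun z => abs_one_sub_cos_inner_le ξ z le_rfl

lemma continuous_ψ (hd : 1 ≤ d) (hν_pos : ∀ r : ℝ, 0 < r → 0 < ν r)
    (hint : Integrable (fun z : EuclideanSpace ℝ (Fin d) => min (‖z‖ ^ 2) 1 * ν ‖z‖)) :
    Continuous (ψ d ν) := by
  refine continuous_iff_continuousAt.2 fun ξ₀ => ?_
  refine continuousAt_of_dominated
    (bound := fun z => 2 * max ((‖ξ₀‖ + 1) ^ 2) 1 * (min (‖z‖ ^ 2) 1 * ν ‖z‖))
    (Eventually.of_forall fun ξ => (integrable_one_sub_cos_mul_levy hd hν_pos hint ξ).1) ?_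
    (hint.const_mul _) (Eventually.of_forall fun z => by fun_prop)
  have hev : ∀ᶠ ξ in nhds ξ₀, ‖ξ‖ < ‖ξ₀‖ + 1 :=
    continuous_norm.continuousAt.eventually_lt continuousAt_const (by simp)
  filter_upwards [hev] with ξ hξ
  filter_upwards [ae_levy_pos hd hν_pos] with z hz
  rw [Real.norm_eq_abs, abs_mul, abs_of_pos hz.2, ← mul_assoc]
  exact mul_le_mul_of_nonneg_right (abs_one_sub_cos_inner_le ξ z hξ.le) hz.2.le

@[simp] lemma ψ_zero : ψ d ν 0 = 0 := by simp [ψ]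

lemma ψ_le_two_mul_hfun (hd : 1 ≤ d) (hν_pos : ∀ r : ℝ, 0 < r → 0 < ν r)
    (hint : Integrable (fun z : EuclideanSpace ℝ (Fin d) => min (‖z‖ ^ 2) 1 * ν ‖z‖))
    {ξ : EuclideanSpace ℝ (Fin d)} {r : ℝ} (hξ : ‖ξ‖ ≤ r) :
    ψ d ν ξ ≤ 2 * hfun d ν r⁻¹ := by
  rw [ψ, hfun, ← integral_const_mul]
  refine integral_mono_ae (integrable_one_sub_cos_mul_levy hd hν_pos hint ξ)
    ((integrable_min_mul_levy hd hν_pos hint _).const_mul _) ?_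
  filter_upwards [ae_levy_pos hd hν_pos] with z hz
  have := mul_le_mul_of_nonneg_right (one_sub_cos_inner_le ξ z hξ) hz.2.le
  rw [← mul_assoc]
  convert this using 4
  rw [inv_pow, div_inv_eq_mul, mul_comm]

lemma bddAbove_ψ (hd : 1 ≤ d) (hν_pos : ∀ r : ℝ, 0 < r → 0 < ν r)
    (hint : Integrable (fun z : EuclideanSpace ℝ (Fin d) => min (‖z‖ ^ 2) 1 * ν ‖z‖)) (r : ℝ) :
    BddAbove {y : ℝ | ∃ z : EuclideanSpace ℝ (Fin d), ‖z‖ ≤ r ∧ ψ d ν z = y} := by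
  refine ⟨2 * hfun d ν r⁻¹, ?_⟩
  rintro _ ⟨z, hz, rfl⟩
  exact ψ_le_two_mul_hfun hd hν_pos hint hz

lemma ψ_le_ψstar (hd : 1 ≤ d) (hν_pos : ∀ r : ℝ, 0 < r → 0 < ν r)
    (hint : Integrable (fun z : EuclideanSpace ℝ (Fin d) => min (‖z‖ ^ 2) 1 * ν ‖z‖))
    {ξ : EuclideanSpace ℝ (Fin d)} {r : ℝ} (hξ : ‖ξ‖ ≤ r) : ψ d ν ξ ≤ ψstar d ν r :=
  le_csSup (bddAbove_ψ hd hν_pos hint r) ⟨ξ, hξ, rfl⟩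

lemma ψstar_le_two_mul_hfun (hd : 1 ≤ d) (hν_pos : ∀ r : ℝ, 0 < r → 0 < ν r)
    (hint : Integrable (fun z : EuclideanSpace ℝ (Fin d) => min (‖z‖ ^ 2) 1 * ν ‖z‖))
    {r : ℝ} (hr : 0 ≤ r) : ψstar d ν r ≤ 2 * hfun d ν r⁻¹ := by
  refine csSup_le ⟨_, 0, by simpa using hr, rfl⟩ ?_
  rintro _ ⟨z, hz, rfl⟩
  exact ψ_le_two_mul_hfun hd hν_pos hint hz

lemma integrable_min_coord_mul_levy (hd : 1 ≤ d) (hν_pos : ∀ r : ℝ, 0 < r → 0 < ν r)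
    (hint : Integrable (fun z : EuclideanSpace ℝ (Fin d) => min (‖z‖ ^ 2) 1 * ν ‖z‖))
    (r : ℝ) (i : Fin d) :
    Integrable (fun z : EuclideanSpace ℝ (Fin d) => min ((r * z i) ^ 2) 1 * ν ‖z‖) := by
  refine integrable_mul_levy hd hν_pos hint (Continuous.aestronglyMeasurable (by fun_prop))
    (max (r ^ 2) 1) fun z => ?_
  rw [abs_of_nonneg (by positivity), mul_pow]
  refine le_trans ?_ (min_mul_le_max_mul_min (by positivity))
  gcongr min (_ * ?_) _
  rw [← sq_abs]
  gcongr
  exact PiLp.norm_apply_le z i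

/-- Averaging `ψ` over a segment on a coordinate axis controls the truncated second moment of that
coordinate. -/
lemma integral_min_coord_le_ψstar (hd : 1 ≤ d) (hν_pos : ∀ r : ℝ, 0 < r → 0 < ν r)
    (hint : Integrable (fun z : EuclideanSpace ℝ (Fin d) => min (‖z‖ ^ 2) 1 * ν ‖z‖))
    {r : ℝ} (hr : 0 ≤ r) (i : Fin d) :
    ∫ z : EuclideanSpace ℝ (Fin d), min ((r * z i) ^ 2) 1 * ν ‖z‖ ≤ 20 * ψstar d ν r := by
  have hψ : ∀ s : ℝ, ψ d ν (EuclideanSpace.single i (s * r))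
      = ∫ z : EuclideanSpace ℝ (Fin d), (1 - Real.cos (s * (r * z i))) * ν ‖z‖ := by
    intro s
    simp only [ψ, EuclideanSpace.inner_single_left, conj_trivial, mul_assoc]
  have hnorm : ∀ s ∈ Set.Icc (0:ℝ) 1, ‖EuclideanSpace.single i (s * r)‖ ≤ r := by
    intro s hs
    rw [PiLp.norm_single, Real.norm_eq_abs, abs_of_nonneg (mul_nonneg hs.1 hr)]
    exact mul_le_of_le_one_left hr hs.2
  have hprod : Integrable (Function.uncurry fun (s : ℝ) (z : EuclideanSpace ℝ (Fin d)) =>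
      (1 - Real.cos (s * (r * z i))) * ν ‖z‖) ((volume.restrict (Set.uIoc 0 1)).prod volume) := by
    have hb : Integrable (fun p : ℝ × EuclideanSpace ℝ (Fin d) =>
        2 * max (r ^ 2) 1 * (min (‖p.2‖ ^ 2) 1 * ν ‖p.2‖))
        ((volume.restrict (Set.uIoc 0 1)).prod volume) :=
      have := isFiniteMeasure_restrict_Ioc (min (0:ℝ) 1) (max 0 1)
      (hint.const_mul _).comp_snd (volume.restrict (Set.Ioc (min 0 1) (max 0 1)))
    refine hb.mono' ?_ ?_
    · refine AEStronglyMeasurable.mul (Continuous.aestronglyMeasurable (by fun_prop)) ?_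
      exact (aestronglyMeasurable_levy hd hint).comp_snd
    · have h1 : ∀ᵐ p : ℝ × EuclideanSpace ℝ (Fin d)
          ∂((volume.restrict (Set.uIoc 0 1)).prod volume), 0 < ν ‖p.2‖ :=
        Measure.quasiMeasurePreserving_snd.ae ((ae_levy_pos hd hν_pos).mono fun _ h => h.2)
      have h2 : ∀ᵐ p : ℝ × EuclideanSpace ℝ (Fin d)
          ∂((volume.restrict (Set.uIoc 0 1)).prod volume), p.1 ∈ Set.uIoc (0:ℝ) 1 :=
        Measure.quasiMeasurePreserving_fst.ae (ae_restrict_mem measurableSet_uIoc)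
      filter_upwards [h1, h2] with p hp hs
      rw [Set.uIoc_of_le zero_le_one] at hs
      have := abs_one_sub_cos_inner_le (EuclideanSpace.single i (p.1 * r)) p.2
        (hnorm p.1 ⟨hs.1.le, hs.2⟩)
      simp only [EuclideanSpace.inner_single_left, conj_trivial, mul_assoc p.1] at this
      simp only [Function.uncurry]
      rw [Real.norm_eq_abs, abs_mul, abs_of_pos hp]
      exact (mul_le_mul_of_nonneg_right this hp.le).trans_eq (mul_assoc _ _ _)
  have hswap := intervalIntegral_integral_swap hprod
  have hle : ∫ s in (0:ℝ)..1, ψ d ν (EuclideanSpace.single i (s * r)) ≤ ψstar d ν r := by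
    have hc : Continuous fun s : ℝ => ψ d ν (EuclideanSpace.single i (s * r)) := by
      refine (continuous_ψ hd hν_pos hint).comp ?_
      have : (fun s : ℝ => EuclideanSpace.single i (s * r))
          = fun s : ℝ => s • (EuclideanSpace.single i r : EuclideanSpace ℝ (Fin d)) := by
        ext s j
        by_cases h : j = i <;> simp [h]
      rw [this]
      fun_prop
    have := intervalIntegral.integral_mono_on (μ := volume) zero_le_one
      (hc.intervalIntegrable _ _)
      (continuous_const (y := ψstar d ν r) |>.intervalIntegrable (0:ℝ) 1)
      fun s hs => ψ_le_ψstar hd hν_pos hint (hnorm s hs)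
    simpa using this
  simp only [hψ] at hle
  rw [hswap] at hle
  have hmono : ∫ z : EuclideanSpace ℝ (Fin d), 1 / 20 * (min ((r * z i) ^ 2) 1 * ν ‖z‖)
      ≤ ∫ z : EuclideanSpace ℝ (Fin d),
          ∫ s in (0:ℝ)..1, (1 - Real.cos (s * (r * z i))) * ν ‖z‖ := by
    refine integral_mono_ae ((integrable_min_coord_mul_levy hd hν_pos hint r i).const_mul _) ?_ ?_
    · have := hprod.integral_prod_right
      simp only [intervalIntegral.integral_of_le (zero_le_one (α := ℝ))]
      simpa [Set.uIoc_of_le (zero_le_one (α := ℝ))] using this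
    · filter_upwards [ae_levy_pos hd hν_pos] with z hz
      rw [intervalIntegral.integral_mul_const, ← mul_assoc]
      exact mul_le_mul_of_nonneg_right (mul_min_le_integral_one_sub_cos _) hz.2.le
  rw [integral_const_mul] at hmono
  linarith

lemma min_sum_le_sum_min {ι : Type*} (s : Finset ι) (f : ι → ℝ) (hf : ∀ i, 0 ≤ f i) :
    min (∑ i ∈ s, f i) 1 ≤ ∑ i ∈ s, min (f i) 1 := by
  by_cases h : ∃ i ∈ s, 1 ≤ f i
  · obtain ⟨i, hi, h1⟩ := h
    refine (min_le_right _ _).trans ?_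
    refine (le_min h1 le_rfl).trans ?_
    exact Finset.single_le_sum (f := fun i => min (f i) 1)
      (fun j _ => le_min (hf j) zero_le_one) hi
  · push Not at h
    exact (min_le_left _ _).trans
      (Finset.sum_le_sum fun i hi => le_min le_rfl (h i hi).le)

lemma hfun_le_mul_ψstar (hd : 1 ≤ d) (hν_pos : ∀ r : ℝ, 0 < r → 0 < ν r)
    (hint : Integrable (fun z : EuclideanSpace ℝ (Fin d) => min (‖z‖ ^ 2) 1 * ν ‖z‖))
    {r : ℝ} (hr : 0 ≤ r) : hfun d ν r⁻¹ ≤ 20 * d * ψstar d ν r := by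
  calc hfun d ν r⁻¹
      ≤ ∫ z : EuclideanSpace ℝ (Fin d), ∑ i, min ((r * z i) ^ 2) 1 * ν ‖z‖ := by
        refine integral_mono_ae (integrable_min_mul_levy hd hν_pos hint _)
          (integrable_finsetSum _ fun i _ => integrable_min_coord_mul_levy hd hν_pos hint r i) ?_
        filter_upwards [ae_levy_pos hd hν_pos] with z hz
        rw [← Finset.sum_mul]
        refine mul_le_mul_of_nonneg_right ?_ hz.2.le
        have := min_sum_le_sum_min Finset.univ (fun i => (r * z i) ^ 2) fun i => sq_nonneg _
        have e : ‖z‖ ^ 2 / r⁻¹ ^ 2 = ∑ i, (r * z i) ^ 2 := by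
          simp only [mul_pow]
          rw [← Finset.mul_sum, inv_pow, div_inv_eq_mul, mul_comm, EuclideanSpace.real_norm_sq_eq]
        rwa [e]
    _ = ∑ i, ∫ z : EuclideanSpace ℝ (Fin d), min ((r * z i) ^ 2) 1 * ν ‖z‖ :=
        integral_finsetSum _ fun i _ => integrable_min_coord_mul_levy hd hν_pos hint r i
    _ ≤ ∑ _i : Fin d, 20 * ψstar d ν r :=
        Finset.sum_le_sum fun i _ => integral_min_coord_le_ψstar hd hν_pos hint hr i
    _ = 20 * d * ψstar d ν r := by simp; ring

/-- Every level exceeded by `ψ` is attained by `ψ*`. -/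
lemma exists_ψstar_eq (hd : 1 ≤ d) (hν_pos : ∀ r : ℝ, 0 < r → 0 < ν r)
    (hint : Integrable (fun z : EuclideanSpace ℝ (Fin d) => min (‖z‖ ^ 2) 1 * ν ‖z‖))
    {u : ℝ} (hu : 0 < u) {η : EuclideanSpace ℝ (Fin d)} (hη : u ≤ ψ d ν η) :
    ∃ r, 0 ≤ r ∧ ψstar d ν r = u := by
  have hc := continuous_ψ hd hν_pos hint
  have hclosed : IsClosed {ξ | ψ d ν ξ = u} := isClosed_eq hc continuous_const
  obtain ⟨ζ, hζ⟩ := mem_range_of_exists_le_of_exists_ge hc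
    ⟨0, by simpa using hu.le⟩ ⟨η, hη⟩
  obtain ⟨ξ, hξ, hmin⟩ := hclosed.exists_infDist_eq_dist ⟨ζ, hζ⟩ 0
  have hmin' : ∀ z, ψ d ν z = u → ‖ξ‖ ≤ ‖z‖ := by
    intro z hz
    have := Metric.infDist_le_dist_of_mem (x := 0) (s := {ξ | ψ d ν ξ = u}) hz
    rwa [hmin, dist_zero_left, dist_zero_left] at this
  refine ⟨‖ξ‖, norm_nonneg _, IsGreatest.csSup_eq ⟨⟨ξ, le_rfl, hξ⟩, ?_⟩⟩
  rintro _ ⟨z, hz, rfl⟩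
  by_contra! hlt
  have hct : ContinuousOn (fun t : ℝ => ψ d ν (t • z)) (Set.Icc 0 1) := by fun_prop
  obtain ⟨t, ht, hteq⟩ := intermediate_value_Icc zero_le_one hct
    (show u ∈ Set.Icc _ _ by simp [hu.le, hlt.le])
  have ht1 : t < 1 := by
    refine ht.2.lt_of_ne ?_
    rintro rfl
    simp only [one_smul] at hteq
    exact hlt.ne' hteq
  have hz0 : 0 < ‖z‖ := by
    refine norm_pos_iff.2 ?_
    rintro rfl
    simp only [ψ_zero] at hlt
    exact absurd hlt hu.not_gt
  have := hmin' _ hteq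
  rw [norm_smul, Real.norm_eq_abs, abs_of_nonneg ht.1] at this
  nlinarith

lemma integral_eq_pow_mul_integral_comp_smul (f : EuclideanSpace ℝ (Fin d) → ℝ) {c : ℝ}
    (hc : 0 < c) : ∫ z, f z = c ^ d * ∫ z, f (c • z) := by
  rw [Measure.integral_comp_smul, finrank_euclideanSpace_fin, abs_of_pos (by positivity),
    smul_eq_mul, mul_inv_cancel_left₀ (by positivity)]

/-- A density that is regularly varying at infinity with index `-d-α`, `α < 2`, has infinite second
moment. -/
lemma not_integrable_sq_mul_levy (hd : 1 ≤ d) (hν_pos : ∀ r : ℝ, 0 < r → 0 < ν r)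
    {α : ℝ} (hα : α < 2)
    (hA2 : Tendsto (fun r : ℝ => ν (2 * r) / ν r) atTop (nhds (2 ^ (-(d:ℝ) - α)))) :
    ¬ Integrable (fun z : EuclideanSpace ℝ (Fin d) => ‖z‖ ^ 2 * ν ‖z‖) := by
  intro hI
  have hlt : ((4:ℝ) * 2 ^ d)⁻¹ < 2 ^ (-(d:ℝ) - α) := by
    have h1 : ((4:ℝ) * 2 ^ d)⁻¹ = 2 ^ (-(d:ℝ) - 2) := by
      rw [Real.rpow_sub two_pos, Real.rpow_neg two_pos.le, Real.rpow_natCast]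
      norm_num
      ring
    rw [h1]
    exact Real.rpow_lt_rpow_of_exponent_lt one_lt_two (by linarith)
  obtain ⟨q, hq1, hq2⟩ := exists_between hlt
  obtain ⟨A₀, hA₀⟩ := eventually_atTop.1 (hA2.eventually_const_lt hq2)
  obtain ⟨A, hAA₀, hA1⟩ : ∃ A, A₀ ≤ A ∧ 1 ≤ A := ⟨max A₀ 1, le_max_left _ _, le_max_right _ _⟩
  have hνq : ∀ r, A ≤ r → q * ν r ≤ ν (2 * r) := fun r hr =>
    ((lt_div_iff₀ (hν_pos r (by linarith))).1 (hA₀ r (hAA₀.trans hr))).le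
  let F : ℝ → EuclideanSpace ℝ (Fin d) → ℝ := fun B =>
    {z | B ≤ ‖z‖}.indicator fun z => ‖z‖ ^ 2 * ν ‖z‖
  have hms : ∀ B : ℝ, MeasurableSet {z : EuclideanSpace ℝ (Fin d) | B ≤ ‖z‖} := fun B =>
    (isClosed_le continuous_const continuous_norm).measurableSet
  have hF : ∀ B, Integrable (F B) := fun B => hI.indicator (hms B)
  have hFnn : ∀ᵐ z, 0 ≤ F A z := by
    filter_upwards [ae_levy_pos hd hν_pos] with z hz
    exact Set.indicator_apply_nonneg (fun _ => mul_nonneg (by positivity) hz.2.le)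
  have hpos : 0 < ∫ z, F A z := by
    rw [integral_pos_iff_support_of_nonneg_ae hFnn (hF A)]
    have hopen : IsOpen {z : EuclideanSpace ℝ (Fin d) | A < ‖z‖} :=
      isOpen_lt continuous_const continuous_norm
    refine (hopen.measure_pos volume ⟨EuclideanSpace.single ⟨0, hd⟩ (A + 1), ?_⟩).trans_le
      (measure_mono fun z hz => ?_)
    · simp only [Set.mem_ofPred_eq, PiLp.norm_single, Real.norm_eq_abs]
      exact (lt_add_one A).trans_le (le_abs_self _)
    · have hz' : A < ‖z‖ := hz
      have := hν_pos ‖z‖ (by linarith)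
      have h0 : 0 < ‖z‖ := by linarith
      simp only [Function.mem_support, F]
      rw [Set.indicator_of_mem (show z ∈ {z | A ≤ ‖z‖} from hz'.le)]
      positivity
  have hle : ∫ z, F (2 * A) z ≤ ∫ z, F A z := by
    refine integral_mono_ae (hF _) (hF _) ?_
    filter_upwards [ae_levy_pos hd hν_pos] with z hz
    by_cases h2 : 2 * A ≤ ‖z‖
    · simp only [F]
      rw [Set.indicator_of_mem (show z ∈ {z | 2 * A ≤ ‖z‖} from h2),
        Set.indicator_of_mem (show z ∈ {z | A ≤ ‖z‖} from (by linarith : A ≤ ‖z‖))]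
    · simp only [F]
      rw [Set.indicator_of_notMem (show z ∉ {z | 2 * A ≤ ‖z‖} from h2)]
      exact Set.indicator_apply_nonneg fun _ => mul_nonneg (by positivity) hz.2.le
  have hge : 4 * q * ∫ z, F A z ≤ ∫ z, F (2 * A) ((2:ℝ) • z) := by
    rw [← integral_const_mul]
    refine integral_mono ((hF A).const_mul _) ((hF _).comp_smul two_ne_zero) fun z => ?_
    have hn : ‖(2:ℝ) • z‖ = 2 * ‖z‖ := by rw [norm_smul]; norm_num
    by_cases hz : A ≤ ‖z‖
    · have h2 : (2:ℝ) • z ∈ {z : EuclideanSpace ℝ (Fin d) | 2 * A ≤ ‖z‖} := by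
        simp only [Set.mem_ofPred_eq, hn]; linarith
      simp only [F]
      rw [Set.indicator_of_mem (show z ∈ {z | A ≤ ‖z‖} from hz), Set.indicator_of_mem h2, hn]
      have := mul_le_mul_of_nonneg_left (hνq _ hz) (sq_nonneg ‖z‖)
      nlinarith
    · have h2 : (2:ℝ) • z ∉ {z : EuclideanSpace ℝ (Fin d) | 2 * A ≤ ‖z‖} := by
        simp only [Set.mem_ofPred_eq, hn]; linarith
      simp only [F]
      rw [Set.indicator_of_notMem (show z ∉ {z | A ≤ ‖z‖} from hz), Set.indicator_of_notMem h2,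
        mul_zero]
  rw [integral_eq_pow_mul_integral_comp_smul (F (2 * A)) two_pos] at hle
  have hq : 1 < 4 * q * 2 ^ d := by
    rw [inv_lt_iff_one_lt_mul₀ (by positivity)] at hq1
    linarith
  have h2 : (2:ℝ) ^ d * (4 * q * ∫ z, F A z) ≤ ∫ z, F A z :=
    (mul_le_mul_of_nonneg_left hge (by positivity)).trans hle
  nlinarith

/-- `r² h(r)` is eventually as large as one likes when the second moment is infinite. -/
lemma exists_forall_div_sq_le_hfun (hd : 1 ≤ d) (hν_pos : ∀ r : ℝ, 0 < r → 0 < ν r)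
    (hint : Integrable (fun z : EuclideanSpace ℝ (Fin d) => min (‖z‖ ^ 2) 1 * ν ‖z‖))
    (hI : ¬ Integrable (fun z : EuclideanSpace ℝ (Fin d) => ‖z‖ ^ 2 * ν ‖z‖)) (M : ℝ) :
    ∃ R₀ : ℝ, 0 < R₀ ∧ ∀ R, R₀ ≤ R → M / R ^ 2 ≤ hfun d ν R := by
  by_contra! hcon
  refine hI ((aecover_ball (x := 0) tendsto_id).integrable_of_integral_bounded_of_nonneg_ae
    (l := (atTop : Filter ℝ)) M (fun R => ?_) ?_ ?_)
  · have h := integrable_mul_levy hd hν_pos hint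
      (f := (Metric.ball (0 : EuclideanSpace ℝ (Fin d)) R).indicator fun z => ‖z‖ ^ 2)
      (AEStronglyMeasurable.indicator (Continuous.aestronglyMeasurable (by fun_prop))
        measurableSet_ball) (max (R ^ 2) 1) ?_
    · rw [← integrable_indicator_iff measurableSet_ball]
      refine h.congr (Eventually.of_forall fun z => ?_)
      simp only [Set.indicator_mul_left, id]
    · intro z
      by_cases hz : z ∈ Metric.ball (0 : EuclideanSpace ℝ (Fin d)) R
      · rw [Set.indicator_of_mem hz, abs_of_nonneg (by positivity)]
        rw [mem_ball_zero_iff] at hz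
        rcases le_total (‖z‖ ^ 2) 1 with h | h
        · rw [min_eq_left h]
          exact le_mul_of_one_le_left (by positivity) (le_max_right _ _)
        · rw [min_eq_right h, mul_one]
          exact le_max_of_le_left (by gcongr)
      · rw [Set.indicator_of_notMem hz, abs_zero]; positivity
  · filter_upwards [ae_levy_pos hd hν_pos] with z hz
    exact mul_nonneg (by positivity) hz.2.le
  · filter_upwards [eventually_gt_atTop 0] with R hR
    obtain ⟨S, hRS, hS⟩ := hcon R hR
    have hS0 : 0 < S := hR.trans_le hRS
    rw [lt_div_iff₀ (by positivity), hfun, ← integral_mul_const] at hS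
    refine le_trans ?_ hS.le
    rw [← integral_indicator measurableSet_ball]
    refine integral_mono_of_nonneg ?_ ((integrable_min_mul_levy hd hν_pos hint S).mul_const _) ?_
    · filter_upwards [ae_levy_pos hd hν_pos] with z hz
      exact Set.indicator_apply_nonneg fun _ => mul_nonneg (by positivity) hz.2.le
    · filter_upwards [ae_levy_pos hd hν_pos] with z hz
      refine Set.indicator_apply_le' (fun hz' => ?_) fun _ =>
        mul_nonneg (mul_nonneg (by positivity) hz.2.le) (by positivity)
      rw [id, mem_ball_zero_iff] at hz'
      rw [min_eq_left (by rw [div_le_one (by positivity)]; gcongr; linarith)]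
      apply le_of_eq
      field_simp

/-- Weak lower scaling of `h` at infinity. -/
lemma exists_hfun_mul_le_half (hd : 1 ≤ d) (hν_pos : ∀ r : ℝ, 0 < r → 0 < ν r)
    (hν_mono : ∀ r₁ r₂ : ℝ, 0 < r₁ → r₁ ≤ r₂ → ν r₂ ≤ ν r₁)
    (hint : Integrable (fun z : EuclideanSpace ℝ (Fin d) => min (‖z‖ ^ 2) 1 * ν ‖z‖))
    {α : ℝ} (hα : α ∈ Set.Ioo (0:ℝ) 2)
    (hA2 : ∀ lam : ℝ, 0 < lam →
      Tendsto (fun r : ℝ => ν (lam * r) / ν r) atTop (nhds (lam ^ (-(d:ℝ) - α)))) :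
    ∃ c R₀ : ℝ, 1 ≤ c ∧ 0 < R₀ ∧ ∀ R, R₀ ≤ R → hfun d ν (c * R) ≤ hfun d ν R / 2 := by
  set c : ℝ := 5 ^ α⁻¹ with hc
  have hc1 : 1 ≤ c := Real.one_le_rpow (by norm_num) (inv_nonneg.2 hα.1.le)
  have hc0 : 0 < c := by linarith
  have hlt : c ^ (-(d:ℝ) - α) < 1 / 4 * (c ^ d)⁻¹ := by
    rw [Real.rpow_sub hc0, Real.rpow_neg hc0.le, Real.rpow_natCast, hc,
      ← Real.rpow_mul (by norm_num), inv_mul_cancel₀ hα.1.ne', Real.rpow_one, ← hc, div_eq_inv_mul]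
    gcongr
    norm_num
  obtain ⟨A₀, hA₀⟩ := eventually_atTop.1 ((hA2 c hc0).eventually_lt_const hlt)
  obtain ⟨A, hAA₀, hA1⟩ : ∃ A, A₀ ≤ A ∧ 1 ≤ A := ⟨max A₀ 1, le_max_left _ _, le_max_right _ _⟩
  have hνq : ∀ r, A ≤ r → c ^ d * ν (c * r) ≤ 1 / 4 * ν r := by
    intro r hr
    have h1 := ((div_lt_iff₀ (hν_pos r (by linarith))).1 (hA₀ r (hAA₀.trans hr))).le
    calc c ^ d * ν (c * r) ≤ c ^ d * (1 / 4 * (c ^ d)⁻¹ * ν r) := by gcongr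
      _ = 1 / 4 * ν r := by field_simp
  obtain ⟨R₀, hR₀, hR⟩ := exists_forall_div_sq_le_hfun hd hν_pos hint
    (not_integrable_sq_mul_levy hd hν_pos hα.2 (hA2 2 two_pos))
    (4 * (c ^ d * A ^ 2 * ∫ z : EuclideanSpace ℝ (Fin d), min (‖z‖ ^ 2) 1 * ν ‖z‖))
  refine ⟨c, R₀, hc1, hR₀, fun R hRR => ?_⟩
  have hR0 : 0 < R := hR₀.trans_le hRR
  have key : hfun d ν (c * R) ≤ 1 / 4 * hfun d ν R + c ^ d * A ^ 2 / R ^ 2 *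
      ∫ z : EuclideanSpace ℝ (Fin d), min (‖z‖ ^ 2) 1 * ν ‖z‖ := by
    have hi1 := (integrable_min_mul_levy hd hν_pos hint R).const_mul (1 / 4)
    have hi2 := hint.const_mul (c ^ d * A ^ 2 / R ^ 2)
    rw [hfun, integral_eq_pow_mul_integral_comp_smul _ hc0, hfun, ← integral_const_mul,
      ← integral_const_mul, ← integral_const_mul, ← integral_add hi1 hi2]
    refine integral_mono_ae
      (((integrable_min_mul_levy hd hν_pos hint (c * R)).comp_smul hc0.ne').const_mul _)
      (hi1.add hi2) ?_
    filter_upwards [ae_levy_pos hd hν_pos] with z hz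
    have hn : ‖c • z‖ = c * ‖z‖ := by rw [norm_smul, Real.norm_eq_abs, abs_of_pos hc0]
    simp only [hn]
    rw [mul_pow, mul_pow, mul_div_mul_left _ _ (by positivity)]
    have hm0 : 0 ≤ min (‖z‖ ^ 2 / R ^ 2) 1 := by positivity
    have hν0 := hz.2.le
    by_cases hzA : A ≤ ‖z‖
    · have h1 := mul_le_mul_of_nonneg_left (hνq _ hzA) hm0
      have h2 : 0 ≤ c ^ d * A ^ 2 / R ^ 2 * (min (‖z‖ ^ 2) 1 * ν ‖z‖) := by positivity
      linarith
    · push Not at hzA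
      have h1 : ν (c * ‖z‖) ≤ ν ‖z‖ := hν_mono _ _ hz.1 (le_mul_of_one_le_left hz.1.le hc1)
      have h2 : ‖z‖ ^ 2 ≤ A ^ 2 * min (‖z‖ ^ 2) 1 := by
        rcases le_total (‖z‖ ^ 2) 1 with h | h
        · rw [min_eq_left h]
          exact le_mul_of_one_le_left (by positivity) (one_le_pow₀ hA1)
        · rw [min_eq_right h, mul_one]
          gcongr
      calc c ^ d * (min (‖z‖ ^ 2 / R ^ 2) 1 * ν (c * ‖z‖))
          ≤ c ^ d * ((A ^ 2 * min (‖z‖ ^ 2) 1) / R ^ 2 * ν ‖z‖) := by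
            gcongr
            · exact (hν_pos _ (mul_pos hc0 hz.1)).le
            · exact (min_le_left _ _).trans (by gcongr)
        _ = 0 + c ^ d * A ^ 2 / R ^ 2 * (min (‖z‖ ^ 2) 1 * ν ‖z‖) := by ring
        _ ≤ _ := by gcongr; positivity
  have h4 := hR R hRR
  have h5 : 4 * (c ^ d * A ^ 2 * ∫ z : EuclideanSpace ℝ (Fin d), min (‖z‖ ^ 2) 1 * ν ‖z‖) / R ^ 2
      = 4 * (c ^ d * A ^ 2 / R ^ 2 *
        ∫ z : EuclideanSpace ℝ (Fin d), min (‖z‖ ^ 2) 1 * ν ‖z‖) := by ring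
  linarith

lemma hfun_pos (hd : 1 ≤ d) (hν_pos : ∀ r : ℝ, 0 < r → 0 < ν r)
    (hanti : StrictAntiOn (hfun d ν) (Set.Ioi 0)) {r : ℝ} (hr : 0 < r) : 0 < hfun d ν r := by
  refine lt_of_le_of_lt ?_ (hanti (Set.mem_Ioi.2 hr) (Set.mem_Ioi.2 (by linarith : 0 < r + 1))
    (by linarith))
  refine integral_nonneg_of_ae ?_
  filter_upwards [ae_levy_pos hd hν_pos] with z hz
  exact mul_nonneg (by positivity) hz.2.le

end Levy

/-- The inverse of a decreasing function vanishing at infinity is doubling as soon as the function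
is halved by some dilation near infinity. -/
lemma exists_doubling_of_scaling {h hinv : ℝ → ℝ} (hanti : StrictAntiOn h (Set.Ioi 0))
    (hlim : Tendsto h atTop (nhds 0)) (hhinv : ∀ u, 0 < u → 0 < hinv u ∧ h (hinv u) = u)
    {c R₀ : ℝ} (hc : 1 ≤ c) (hR₀ : 0 < R₀) (hscal : ∀ R, R₀ ≤ R → h (c * R) ≤ h R / 2)
    (hpos : ∀ R, 0 < R → 0 < h R) {r : ℝ} (hr : 0 < r) :
    ∃ C : ℝ, 1 ≤ C ∧ ∀ u : ℝ, 0 < u → 2 * u < r → hinv u ≤ C * hinv (2 * u) := by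
  obtain ⟨B, hB0, hB⟩ : ∃ B, 0 < B ∧ h B < h R₀ / 2 := by
    have h1 := hlim.eventually_lt_const (half_pos (hpos R₀ hR₀))
    obtain ⟨B, h2, h3⟩ := (h1.and (eventually_gt_atTop 0)).exists
    exact ⟨B, h3, h2⟩
  have hr0 := (hhinv r hr).1
  refine ⟨max c (B / hinv r), le_max_of_le_left hc, fun u hu hur => ?_⟩
  obtain ⟨hu0, hu1⟩ := hhinv u hu
  obtain ⟨hv0, hv1⟩ := hhinv (2 * u) (by linarith)
  have hrv : hinv r ≤ hinv (2 * u) := by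
    rw [← hanti.le_iff_ge hv0 hr0, hv1, (hhinv r hr).2]
    exact hur.le
  rcases le_total R₀ (hinv (2 * u)) with hR | hR
  · refine le_trans ?_ (mul_le_mul_of_nonneg_right (le_max_left c _) hv0.le)
    have hcv : 0 < c * hinv (2 * u) := mul_pos (by linarith) hv0
    rw [← hanti.le_iff_ge hcv hu0, hu1]
    have := hscal _ hR
    rw [hv1] at this
    linarith
  · have h1 : h R₀ ≤ 2 * u := by
      rw [← hv1, hanti.le_iff_ge hR₀ hv0]
      exact hR
    have h2 : hinv u ≤ B := by
      rw [← hanti.le_iff_ge hB0 hu0, hu1]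
      linarith
    calc hinv u ≤ B / hinv r * hinv r := by rwa [div_mul_cancel₀ _ hr0.ne']
      _ ≤ _ := by gcongr; exact le_max_right _ _

/-- Iterated doubling: the inverse is comparable at `u` and `b u` for every fixed `b`. -/
lemma exists_le_mul_of_doubling {hinv : ℝ → ℝ}
    (hdoub : ∀ r : ℝ, 0 < r → ∃ C : ℝ, 1 ≤ C ∧
      ∀ u : ℝ, 0 < u → 2 * u < r → hinv u ≤ C * hinv (2 * u))
    (n : ℕ) {r : ℝ} (hr : 0 < r) :
    ∃ C : ℝ, 1 ≤ C ∧ ∀ u : ℝ, 0 < u → u < r → hinv u ≤ C * hinv (2 ^ n * u) := by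
  induction n with
  | zero => exact ⟨1, le_rfl, fun u _ _ => by simp⟩
  | succ n ih =>
    obtain ⟨C₁, h1, H1⟩ := ih
    obtain ⟨C₂, h2, H2⟩ := hdoub (2 ^ (n + 1) * r) (by positivity)
    refine ⟨C₁ * C₂, one_le_mul_of_one_le_of_one_le h1 h2, fun u hu hur => ?_⟩
    have h3 := H2 (2 ^ n * u) (by positivity) (by rw [← mul_assoc, ← pow_succ']; gcongr)
    rw [← mul_assoc, ← pow_succ'] at h3
    calc hinv u ≤ C₁ * hinv (2 ^ n * u) := H1 u hu hur
      _ ≤ C₁ * (C₂ * hinv (2 ^ (n + 1) * u)) := by gcongr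
      _ = _ := by ring

theorem statement5
    (d : ℕ) (hd : 1 ≤ d) (ν : ℝ → ℝ)
    (hν_pos : ∀ r : ℝ, 0 < r → 0 < ν r)
    (hν_mono : ∀ r₁ r₂ : ℝ, 0 < r₁ → r₁ ≤ r₂ → ν r₂ ≤ ν r₁)
    (hint : Integrable (fun z : EuclideanSpace ℝ (Fin d) => min (‖z‖ ^ 2) 1 * ν ‖z‖))
    (hninf : ¬ Integrable (fun z : EuclideanSpace ℝ (Fin d) => ν ‖z‖))
    (α : ℝ) (hα : α ∈ Set.Ioo (0:ℝ) 2)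
    (hA2 : ∀ lam : ℝ, 0 < lam →
      Tendsto (fun r : ℝ => ν (lam * r) / ν r) atTop (nhds (lam ^ (-(d:ℝ) - α))))
    (hcont : ContinuousOn (hfun d ν) (Set.Ioi 0))
    (hanti : StrictAntiOn (hfun d ν) (Set.Ioi 0))
    (hlim0 : Tendsto (hfun d ν) (nhdsWithin 0 (Set.Ioi 0)) atTop)
    (hliminfty : Tendsto (hfun d ν) atTop (nhds 0))
    (hinv : ℝ → ℝ)
    (hhinv : ∀ u : ℝ, 0 < u → 0 < hinv u ∧ hfun d ν (hinv u) = u)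
    (hhinv' : ∀ r : ℝ, 0 < r → hinv (hfun d ν r) = r)
:
    (∀ r : ℝ, 0 < r → ∃ C : ℝ, 1 ≤ C ∧
        ∀ u : ℝ, 0 < u → 2 * u < r → hinv u ≤ C * hinv (2 * u)) ∧
    (∀ r : ℝ, 0 < r → ∃ c : ℝ, 1 ≤ c ∧
        ∀ u : ℝ, 0 < u → u < r →
          c⁻¹ / hinv u ≤ ψinv d ν u ∧ ψinv d ν u ≤ c / hinv u) := by
  have hdpos : (0:ℝ) < d := by exact_mod_cast hd
  have hpos : ∀ R, 0 < R → 0 < hfun d ν R := fun R hR => hfun_pos hd hν_pos hanti hR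
  obtain ⟨a, R₀, ha, hR₀, hscal⟩ := exists_hfun_mul_le_half hd hν_pos hν_mono hint hα hA2
  have hdoub : ∀ r : ℝ, 0 < r → ∃ C : ℝ, 1 ≤ C ∧
      ∀ u : ℝ, 0 < u → 2 * u < r → hinv u ≤ C * hinv (2 * u) := fun r hr =>
    exists_doubling_of_scaling hanti hliminfty hhinv ha hR₀ hscal hpos hr
  refine ⟨hdoub, fun r hr => ?_⟩
  obtain ⟨C₁, h1, H1⟩ := hdoub r hr
  obtain ⟨n, hn⟩ := pow_unbounded_of_one_lt (20 * d : ℝ) one_lt_two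
  obtain ⟨C₂, h2, H2⟩ := exists_le_mul_of_doubling hdoub n hr
  refine ⟨max C₁ C₂, le_max_of_le_left h1, fun u hu hur => ?_⟩
  have hu0 := (hhinv u hu).1
  have hbounds : ∀ ρ, 0 ≤ ρ ∧ ψstar d ν ρ = u →
      (max C₁ C₂)⁻¹ / hinv u ≤ ρ ∧ ρ ≤ max C₁ C₂ / hinv u := by
    rintro ρ ⟨hρ, hρu⟩
    have hup := ψstar_le_two_mul_hfun hd hν_pos hint hρ
    have hlow := hfun_le_mul_ψstar hd hν_pos hint hρ
    rw [hρu] at hup hlow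
    have hρ0 : 0 < ρ := by
      refine hρ.lt_of_ne ?_
      rintro rfl
      simp only [hfun, inv_zero, ne_eq, OfNat.ofNat_ne_zero, not_false_eq_true, zero_pow, div_zero,
        zero_le_one, inf_of_le_left, zero_mul, integral_zero, mul_zero] at hup
      linarith
    have hρi : 0 < ρ⁻¹ := inv_pos.2 hρ0
    constructor
    · obtain ⟨hw0, hw1⟩ := hhinv (u / 2) (by positivity)
      have h3 : ρ⁻¹ ≤ hinv (u / 2) := by
        rw [← hanti.le_iff_ge hw0 hρi, hw1]
        linarith
      have h4 := H1 (u / 2) (by positivity) (by linarith)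
      rw [mul_div_cancel₀ _ two_ne_zero] at h4
      have h5 : ρ⁻¹ ≤ max C₁ C₂ * hinv u :=
        (h3.trans h4).trans (by gcongr; exact le_max_left _ _)
      rw [div_eq_mul_inv, ← mul_inv]
      exact inv_le_of_inv_le₀ hρ0 h5
    · obtain ⟨hw0, hw1⟩ := hhinv (2 ^ n * u) (by positivity)
      have h3 : hinv (2 ^ n * u) ≤ ρ⁻¹ := by
        rw [← hanti.le_iff_ge hρi hw0, hw1]
        exact hlow.trans (by gcongr)
      have h4 : hinv u ≤ max C₁ C₂ * ρ⁻¹ := (H2 u hu hur).trans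
        (mul_le_mul (le_max_right _ _) h3 hw0.le (by positivity))
      rw [le_div_iff₀ hu0, mul_comm, ← le_div_iff₀ hρ0, div_eq_mul_inv]
      exact h4
  obtain ⟨η, hη⟩ : ∃ η, u ≤ ψ d ν η := by
    by_contra! hcon
    obtain ⟨hw0, hw1⟩ := hhinv (20 * d * u + 1) (by positivity)
    have h3 := hfun_le_mul_ψstar hd hν_pos hint (inv_nonneg.2 hw0.le)
    have h4 : ψstar d ν (hinv (20 * d * u + 1))⁻¹ ≤ u := by
      refine csSup_le ⟨_, 0, by simpa using hw0.le, rfl⟩ ?_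
      rintro _ ⟨z, -, rfl⟩
      exact (hcon z).le
    rw [inv_inv, hw1] at h3
    have h5 := mul_le_mul_of_nonneg_left h4 (by positivity : (0:ℝ) ≤ 20 * d)
    linarith
  obtain ⟨ρ, hρ⟩ := exists_ψstar_eq hd hν_pos hint hu hη
  have hbdd : BddAbove {ρ : ℝ | 0 ≤ ρ ∧ ψstar d ν ρ = u} := ⟨_, fun σ hσ => (hbounds σ hσ).2⟩
  exact ⟨(hbounds ρ hρ).1.trans (le_csSup hbdd hρ), csSup_le ⟨ρ, hρ⟩ fun σ hσ => (hbounds σ hσ).2⟩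

end
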